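/- Assume λ₀ > 0. For the joint sensing scheme (T₁₅ = T, all other times 0, so the output is the single variable Y₁₅ which, given X, is Poisson with rate T·(X₁+X₂+X₃+X₄)), the mutual information I(X; Y₁₅) converges to H(X₁+X₂+X₃+X₄), the Shannon entropy of the sum X₁+X₂+X₃+X₄, as T → ∞. -/

import Mathlib

open MeasureTheory ProbabilityTheory Real Filter

noncomputable section

/-- Shannon entropy of a measure: the sum of `-q * log q` over the normalized
masses of singletons (Mathlib-style `measureEntropy`). -/
def measureEntropy {S : Type*} [MeasurableSpace S] (μ : Measure S) : ℝ :=
  ∑' s, Real.negMulLog (((μ Set.univ)⁻¹ • μ) {s}).toReal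

/-- Mutual information of a joint law on a product space:
`I(X;Y) = H(X) + H(Y) - H(X,Y)`. -/
def measureMutualInfo {S U : Type*} [MeasurableSpace S] [MeasurableSpace U]
    (μ : Measure (S × U)) : ℝ :=
  measureEntropy (μ.map Prod.fst) + measureEntropy (μ.map Prod.snd) - measureEntropy μ

/-- The 15 nonempty subsets of `{1,2,3,4}` (coded as `Fin 4`), in the paper's order:
`S₁={1}, S₂={2}, S₃={3}, S₄={4}, S₅={1,2}, S₆={1,3}, S₇={1,4}, S₈={2,3}, S₉={2,4},
S₁₀={3,4}, S₁₁={1,2,3}, S₁₂={1,2,4}, S₁₃={1,3,4}, S₁₄={2,3,4}, S₁₅={1,2,3,4}`. -/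
def sens : Fin 15 → Finset (Fin 4) :=
  ![{0}, {1}, {2}, {3}, {0,1}, {0,2}, {0,3}, {1,2}, {1,3}, {2,3},
    {0,1,2}, {0,1,3}, {0,2,3}, {1,2,3}, {0,1,2,3}]

/-- Law of one input component: `λ₁` with probability `p`, `λ₀` with probability `1-p`. -/
def inputLaw (p lam0 lam1 : ℝ) : Measure ℝ :=
  ENNReal.ofReal p • Measure.dirac lam1 + ENNReal.ofReal (1 - p) • Measure.dirac lam0

/-- Law of the input vector `X = (X₁,X₂,X₃,X₄)` with i.i.d. components. -/
def XLaw (p lam0 lam1 : ℝ) : Measure (Fin 4 → ℝ) :=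
  Measure.pi fun _ => inputLaw p lam0 lam1

/-- Poisson distribution on `ℕ` with (nonnegative) real rate `r`;
rate `0` gives the Dirac mass at `0`. -/
def poissonMeasure (r : ℝ) : Measure ℕ :=
  (poissonPMF r.toNNReal).toMeasure

/-- Joint law of `(X, (Y_{idx 1}, …, Y_{idx k}))` in the vector Poisson channel:
conditionally on `X = x`, the indicated outputs are independent with
`Y_i ~ Poisson (T i * ∑_{j ∈ Sᵢ} x j)`. -/
def poissonJointLaw (p lam0 lam1 : ℝ) (T : Fin 15 → ℝ) {k : ℕ} (idx : Fin k → Fin 15) :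
    Measure ((Fin 4 → ℝ) × (Fin k → ℕ)) :=
  (XLaw p lam0 lam1).bind fun x =>
    (Measure.pi fun i => poissonMeasure (T (idx i) * ∑ j ∈ sens (idx i), x j)).map
      (fun y => (x, y))

lemma sqrt_sum_le_sum_sqrt {ι : Type*} (s : Finset ι) (f : ι → ℝ) :
    √(∑ i ∈ s, f i) ≤ ∑ i ∈ s, √(f i) := by
  refine s.le_sum_of_subadditive Real.sqrt Real.sqrt_zero.le (fun x y => ?_) f
  refine Real.sqrt_le_iff.2 ⟨by positivity, ?_⟩
  nlinarith [Real.sq_sqrt' (x := x), Real.sq_sqrt' (x := y), le_max_left x 0, le_max_left y 0,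
    Real.sqrt_nonneg x, Real.sqrt_nonneg y]

lemma log_one_add_le_two_mul_sqrt {u : ℝ} (hu : 0 ≤ u) : log (1 + u) ≤ 2 * √u := by
  have h := Real.sqrt_nonneg u
  calc log (1 + u) ≤ log ((1 + √u) ^ 2) := by
        gcongr
        nlinarith [Real.sq_sqrt hu]
    _ = 2 * log (1 + √u) := by rw [log_pow]; norm_num
    _ ≤ 2 * √u := by linarith [Real.log_le_sub_one_of_pos (show 0 < 1 + √u by linarith)]

lemma negMulLog_add_mul_log_nonneg {a b : ℝ} (ha : 0 ≤ a) (hb : 0 ≤ b) :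
    0 ≤ negMulLog a + a * log (a + b) := by
  rcases ha.eq_or_lt with rfl | ha
  · simp
  · have : log a ≤ log (a + b) := by gcongr; linarith
    rw [negMulLog]
    nlinarith

lemma negMulLog_add_mul_log_le {a b : ℝ} (ha : 0 ≤ a) (hb : 0 ≤ b) :
    negMulLog a + a * log (a + b) ≤ 2 * √(a * b) := by
  rcases ha.eq_or_lt with rfl | ha
  · simp
  · have h := mul_le_mul_of_nonneg_left (log_one_add_le_two_mul_sqrt (div_nonneg hb ha.le)) ha.le
    rw [show 1 + b / a = (a + b) / a by field_simp, log_div (by positivity) ha.ne'] at h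
    have e : a * √(b / a) = √(a * b) := by
      rw [← Real.sqrt_sq ha.le, ← Real.sqrt_mul (sq_nonneg a), Real.sqrt_sq ha.le]
      congr 1
      field_simp
    rw [negMulLog]
    linarith

lemma sum_negMulLog_sub_negMulLog_sum {ι : Type*} (s : Finset ι) (a : ι → ℝ) :
    ∑ i ∈ s, negMulLog (a i) - negMulLog (∑ i ∈ s, a i) =
      ∑ i ∈ s, (negMulLog (a i) + a i * log (∑ j ∈ s, a j)) := by
  rw [Finset.sum_add_distrib, ← Finset.sum_mul]
  simp only [negMulLog]
  ring

lemma sum_negMulLog_sub_negMulLog_sum_nonneg {ι : Type*} [DecidableEq ι] (s : Finset ι)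
    {a : ι → ℝ} (ha : ∀ i ∈ s, 0 ≤ a i) :
    0 ≤ ∑ i ∈ s, negMulLog (a i) - negMulLog (∑ i ∈ s, a i) := by
  rw [sum_negMulLog_sub_negMulLog_sum]
  refine Finset.sum_nonneg fun i hi => ?_
  rw [← Finset.add_sum_erase s a hi]
  exact negMulLog_add_mul_log_nonneg (ha i hi)
    (Finset.sum_nonneg fun j hj => ha j (Finset.mem_of_mem_erase hj))

lemma sum_negMulLog_sub_negMulLog_sum_le {ι : Type*} [DecidableEq ι] (s : Finset ι)
    {a : ι → ℝ} (ha : ∀ i ∈ s, 0 ≤ a i) :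
    ∑ i ∈ s, negMulLog (a i) - negMulLog (∑ i ∈ s, a i) ≤
      ∑ i ∈ s, ∑ j ∈ s.erase i, 2 * √(a i * a j) := by
  rw [sum_negMulLog_sub_negMulLog_sum]
  refine Finset.sum_le_sum fun i hi => ?_
  rw [← Finset.add_sum_erase s a hi]
  refine (negMulLog_add_mul_log_le (ha i hi)
    (Finset.sum_nonneg fun j hj => ha j (Finset.mem_of_mem_erase hj))).trans ?_
  rw [← Finset.mul_sum, Finset.mul_sum]
  gcongr
  exact sqrt_sum_le_sum_sqrt _ _

/-- The mass which the Poisson law of rate `r` gives to `n`. -/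
def poissonMass (r : ℝ) (n : ℕ) : ℝ := exp (-r) * (r ^ n / n.factorial)

lemma poissonMass_nonneg {r : ℝ} (hr : 0 ≤ r) (n : ℕ) : 0 ≤ poissonMass r n := by
  unfold poissonMass; positivity

lemma hasSum_pow_div_factorial (r : ℝ) :
    HasSum (fun n : ℕ => r ^ n / n.factorial) (exp r) := by
  rw [exp_eq_exp_ℝ]
  exact NormedSpace.expSeries_div_hasSum_exp r

lemma hasSum_poissonMass (r : ℝ) : HasSum (poissonMass r) 1 := by
  have h := (hasSum_pow_div_factorial r).mul_left (exp (-r))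
  rwa [← exp_add, neg_add_cancel, exp_zero] at h

lemma poissonMass_le_one {r : ℝ} (hr : 0 ≤ r) (n : ℕ) : poissonMass r n ≤ 1 :=
  le_hasSum (hasSum_poissonMass r) n fun _ _ => poissonMass_nonneg hr _

lemma negMulLog_le_mul_add_inv_two_pow {p : ℝ} (hp : 0 ≤ p) (n : ℕ) :
    negMulLog p ≤ p * 2 ^ n + (1 / 2) ^ n := by
  rcases hp.eq_or_lt with rfl | hp
  · simp
  have h1 : log ((1 / 2) ^ n / p) ≤ (1 / 2) ^ n / p - 1 := log_le_sub_one_of_pos (by positivity)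
  have h2 : log (2 ^ n : ℝ) ≤ 2 ^ n - 1 := log_le_sub_one_of_pos (by positivity)
  rw [one_div, inv_pow] at *
  rw [log_div (by positivity) hp.ne', log_inv] at h1
  have h3 : -log p ≤ 2 ^ n + (2 ^ n)⁻¹ / p := by linarith
  calc negMulLog p = p * -log p := by rw [negMulLog]; ring
    _ ≤ p * (2 ^ n + (2 ^ n)⁻¹ / p) := by gcongr
    _ = _ := by field_simp

lemma summable_negMulLog_poissonMass {r : ℝ} (hr : 0 ≤ r) :
    Summable fun n => negMulLog (poissonMass r n) := by
  refine Summable.of_nonneg_of_le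
    (fun n => negMulLog_nonneg (poissonMass_nonneg hr n) (poissonMass_le_one hr n))
    (fun n => negMulLog_le_mul_add_inv_two_pow (poissonMass_nonneg hr n) n) (.add ?_ ?_)
  · refine ((hasSum_pow_div_factorial (r * 2)).summable.mul_left (exp (-r))).congr fun n => ?_
    rw [poissonMass, mul_pow]
    ring
  · exact summable_geometric_of_lt_one (by norm_num) (by norm_num)

/-- The Bhattacharyya coefficient of two Poisson laws. -/
lemma hasSum_sqrt_poissonMass_mul {a b : ℝ} (ha : 0 ≤ a) (hb : 0 ≤ b) :
    HasSum (fun n => √(poissonMass a n * poissonMass b n)) (exp (-((√a - √b) ^ 2 / 2))) := by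
  convert! (hasSum_pow_div_factorial (√a * √b)).mul_left (exp (-((a + b) / 2))) using 1
  · ext n
    rw [Real.sqrt_eq_iff_mul_self_eq
      (mul_nonneg (poissonMass_nonneg ha n) (poissonMass_nonneg hb n)) (by positivity)]
    have e : exp (-((a + b) / 2)) * exp (-((a + b) / 2)) = exp (-a) * exp (-b) := by
      rw [← exp_add, ← exp_add]; ring_nf
    have q : (√a * √b) ^ n * (√a * √b) ^ n = a ^ n * b ^ n := by
      rw [← mul_pow, mul_mul_mul_comm, Real.mul_self_sqrt ha, Real.mul_self_sqrt hb, mul_pow]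
    unfold poissonMass
    linear_combination -((√a * √b) ^ n / n.factorial) ^ 2 * e -
      exp (-a) * exp (-b) / n.factorial ^ 2 * q
  · rw [← exp_add]
    congr 1
    linear_combination (-1 / 2) * Real.sq_sqrt ha + (-1 / 2) * Real.sq_sqrt hb

lemma tendsto_exp_neg_sq_sqrt_sub_sqrt {a b : ℝ} (ha : 0 ≤ a) (hb : 0 ≤ b) (hab : a ≠ b) :
    Tendsto (fun T : ℝ => exp (-((√(T * a) - √(T * b)) ^ 2 / 2))) atTop (nhds 0) := by
  have hd : 0 < (√a - √b) ^ 2 / 2 := by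
    have : √a - √b ≠ 0 := fun h => hab ((Real.sqrt_inj ha hb).1 (sub_eq_zero.1 h))
    positivity
  refine (tendsto_exp_neg_atTop_nhds_zero.comp (tendsto_id.atTop_mul_const hd)).congr' ?_
  filter_upwards [eventually_ge_atTop 0] with T hT
  rw [Function.comp_apply, id, Real.sqrt_mul hT, Real.sqrt_mul hT]
  congr 2
  linear_combination (-(√a - √b) ^ 2 / 2) * Real.sq_sqrt hT

lemma hasSum_negMulLog_mul_poissonMass (w : ℝ) {r : ℝ} (hr : 0 ≤ r) :
    HasSum (fun n => negMulLog (w * poissonMass r n))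
      (negMulLog w + w * ∑' n, negMulLog (poissonMass r n)) := by
  simp only [negMulLog_mul]
  refine .add ?_ ((summable_negMulLog_poissonMass hr).hasSum.mul_left _)
  simpa using (hasSum_poissonMass r).mul_right (negMulLog w)

/-- The difference between the entropy of the weights `q` and the mutual information of the
Poisson channel with rates in `s` is small when these rates are far apart. -/
lemma poisson_mixture_entropy_bounds {ι : Type*} [DecidableEq ι] (s : Finset ι) {q r : ι → ℝ}
    (hq : ∀ t ∈ s, 0 ≤ q t) (hr : ∀ t ∈ s, 0 ≤ r t) :
    let I := ∑' n, negMulLog (∑ t ∈ s, q t * poissonMass (r t) n) -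
      ∑ t ∈ s, q t * ∑' n, negMulLog (poissonMass (r t) n)
    I ≤ ∑ t ∈ s, negMulLog (q t) ∧ ∑ t ∈ s, negMulLog (q t) - I ≤
      ∑ i ∈ s, ∑ j ∈ s.erase i, 2 * √(q i * q j) * exp (-((√(r i) - √(r j)) ^ 2 / 2)) := by
  intro I
  have ha (n : ℕ) : ∀ t ∈ s, 0 ≤ q t * poissonMass (r t) n := fun t ht =>
    mul_nonneg (hq t ht) (poissonMass_nonneg (hr t ht) n)
  set D : ℕ → ℝ := fun n => ∑ t ∈ s, negMulLog (q t * poissonMass (r t) n) -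
    negMulLog (∑ t ∈ s, q t * poissonMass (r t) n) with hD
  have hD0 (n : ℕ) : 0 ≤ D n := sum_negMulLog_sub_negMulLog_sum_nonneg s (ha n)
  have hDle (n : ℕ) : D n ≤ ∑ i ∈ s, ∑ j ∈ s.erase i,
      2 * √(q i * q j) * √(poissonMass (r i) n * poissonMass (r j) n) := by
    refine (sum_negMulLog_sub_negMulLog_sum_le s (ha n)).trans (le_of_eq ?_)
    refine Finset.sum_congr rfl fun i hi => Finset.sum_congr rfl fun j hj => ?_
    rw [mul_mul_mul_comm,
      Real.sqrt_mul (mul_nonneg (hq i hi) (hq j (Finset.mem_of_mem_erase hj))), mul_assoc]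
  have hB : HasSum (fun n => ∑ i ∈ s, ∑ j ∈ s.erase i,
      2 * √(q i * q j) * √(poissonMass (r i) n * poissonMass (r j) n))
      (∑ i ∈ s, ∑ j ∈ s.erase i, 2 * √(q i * q j) * exp (-((√(r i) - √(r j)) ^ 2 / 2))) :=
    hasSum_sum fun i hi => hasSum_sum fun j hj =>
      (hasSum_sqrt_poissonMass_mul (hr i hi) (hr j (Finset.mem_of_mem_erase hj))).mul_left _
  have hDs : Summable D := .of_nonneg_of_le hD0 hDle hB.summable
  have hE : HasSum (fun n => ∑ t ∈ s, negMulLog (q t * poissonMass (r t) n))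
      (∑ t ∈ s, (negMulLog (q t) + q t * ∑' n, negMulLog (poissonMass (r t) n))) :=
    hasSum_sum fun t ht => hasSum_negMulLog_mul_poissonMass _ (hr t ht)
  have hI : I = ∑ t ∈ s, negMulLog (q t) - ∑' n, D n := by
    have := (hE.sub hDs.hasSum).tsum_eq
    simp only [hD, sub_sub_cancel] at this
    simp only [I, hD, this, Finset.sum_add_distrib]
    ring
  have h1 : 0 ≤ ∑' n, D n := tsum_nonneg hD0
  have h2 := hDs.tsum_le_tsum hDle hB.summable
  rw [hB.tsum_eq] at h2
  constructor <;> linarith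

lemma tendsto_poisson_mixture_mutualInfo (s : Finset ℝ) {q : ℝ → ℝ} (hq : ∀ t ∈ s, 0 ≤ q t)
    (hs : ∀ t ∈ s, 0 ≤ t) :
    Tendsto (fun T : ℝ => ∑' n, negMulLog (∑ t ∈ s, q t * poissonMass (T * t) n) -
      ∑ t ∈ s, q t * ∑' n, negMulLog (poissonMass (T * t) n)) atTop
      (nhds (∑ t ∈ s, negMulLog (q t))) := by
  have h0 : Tendsto (fun T : ℝ => ∑ t ∈ s, negMulLog (q t) - ∑ i ∈ s, ∑ j ∈ s.erase i,
      2 * √(q i * q j) * exp (-((√(T * i) - √(T * j)) ^ 2 / 2))) atTop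
      (nhds (∑ t ∈ s, negMulLog (q t) - ∑ i ∈ s, ∑ j ∈ s.erase i, 2 * √(q i * q j) * 0)) := by
    refine tendsto_const_nhds.sub (tendsto_finsetSum _ fun i hi => tendsto_finsetSum _ fun j hj =>
      tendsto_const_nhds.mul ?_)
    exact tendsto_exp_neg_sq_sqrt_sub_sqrt (hs i hi) (hs j (Finset.mem_of_mem_erase hj))
      (Finset.ne_of_mem_erase hj).symm
  simp only [mul_zero, Finset.sum_const_zero, sub_zero] at h0
  refine tendsto_of_tendsto_of_tendsto_of_le_of_le' h0 tendsto_const_nhds ?_ ?_ <;>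
  · filter_upwards [eventually_ge_atTop 0] with T hT
    have := poisson_mixture_entropy_bounds s hq (r := fun t => T * t)
      fun t ht => mul_nonneg hT (hs t ht)
    dsimp only at this
    linarith [this.1, this.2]

lemma measureEntropy_eq_tsum_real {S : Type*} [MeasurableSpace S] (μ : Measure S)
    [IsProbabilityMeasure μ] : measureEntropy μ = ∑' s, negMulLog (μ.real {s}) := by
  simp [measureEntropy, measureReal_def]

lemma measureEntropy_eq_tsum_of_injective {S ι : Type*} [MeasurableSpace S] (μ : Measure S)
    [IsProbabilityMeasure μ] {g : ι → S} (hg : g.Injective)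
    (h : ∀ s ∉ Set.range g, μ.real {s} = 0) :
    measureEntropy μ = ∑' i, negMulLog (μ.real {g i}) := by
  rw [measureEntropy_eq_tsum_real]
  refine (hg.tsum_eq (f := fun s => negMulLog (μ.real {s})) fun s hs => ?_).symm
  by_contra hs'
  exact hs (by simp [h s hs'])

/-- The law of one biased coin. -/
def coinLaw (p : ℝ) : Measure Bool :=
  ENNReal.ofReal p • Measure.dirac true + ENNReal.ofReal (1 - p) • Measure.dirac false

lemma isProbabilityMeasure_coinLaw {p : ℝ} (hp0 : 0 ≤ p) (hp1 : p ≤ 1) :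
    IsProbabilityMeasure (coinLaw p) := by
  constructor
  simp [coinLaw, ← ENNReal.ofReal_add hp0 (sub_nonneg.2 hp1)]

instance (p : ℝ) : IsFiniteMeasure (coinLaw p) := by
  constructor
  simp [coinLaw]

/-- The law of four independent biased coins. -/
def coinsLaw (p : ℝ) : Measure (Fin 4 → Bool) := Measure.pi fun _ => coinLaw p

instance (p : ℝ) : IsFiniteMeasure (coinsLaw p) := by
  unfold coinsLaw; infer_instance

lemma isProbabilityMeasure_coinsLaw {p : ℝ} (hp0 : 0 ≤ p) (hp1 : p ≤ 1) :
    IsProbabilityMeasure (coinsLaw p) := by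
  have := isProbabilityMeasure_coinLaw hp0 hp1
  unfold coinsLaw; infer_instance

/-- The input vector encoded by four coins. -/
def signal (lam0 lam1 : ℝ) (b : Fin 4 → Bool) (j : Fin 4) : ℝ := bif b j then lam1 else lam0

lemma signal_injective {lam0 lam1 : ℝ} (h : lam0 ≠ lam1) : (signal lam0 lam1).Injective := by
  intro b c hbc
  ext1 j
  have := congrFun hbc j
  cases hb : b j <;> cases hc : c j <;> simp_all [signal]

lemma measurableEmbedding_signal {lam0 lam1 : ℝ} (h : lam0 ≠ lam1) :
    MeasurableEmbedding (signal lam0 lam1) where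
  injective := signal_injective h
  measurable := .of_discrete
  measurableSet_image' s _ := (s.toFinite.image _).measurableSet

lemma XLaw_eq_map (p lam0 lam1 : ℝ) :
    XLaw p lam0 lam1 = (coinsLaw p).map (signal lam0 lam1) := by
  have h : inputLaw p lam0 lam1 = (coinLaw p).map fun c => bif c then lam1 else lam0 := by
    rw [coinLaw, Measure.map_add _ _ .of_discrete, Measure.map_smul, Measure.map_smul,
      Measure.map_dirac' .of_discrete, Measure.map_dirac' .of_discrete]
    rfl
  rw [XLaw, h, coinsLaw]
  exact (Measure.pi_map_pi fun _ => Measurable.of_discrete.aemeasurable).symm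

lemma isProbabilityMeasure_XLaw {p : ℝ} (hp0 : 0 ≤ p) (hp1 : p ≤ 1) (lam0 lam1 : ℝ) :
    IsProbabilityMeasure (XLaw p lam0 lam1) := by
  have := isProbabilityMeasure_coinsLaw hp0 hp1
  rw [XLaw_eq_map]
  exact Measure.isProbabilityMeasure_map Measurable.of_discrete.aemeasurable

instance (r : ℝ) : IsProbabilityMeasure (_root_.poissonMeasure r) := by
  unfold _root_.poissonMeasure; infer_instance

lemma real_poissonMeasure_singleton {r : ℝ} (hr : 0 ≤ r) (n : ℕ) :
    (_root_.poissonMeasure r).real {n} = poissonMass r n := by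
  rw [measureReal_def, _root_.poissonMeasure,
    PMF.toMeasure_apply_singleton _ _ (measurableSet_singleton n)]
  change (ENNReal.ofReal (exp (-(r.toNNReal : ℝ)) * (r.toNNReal : ℝ) ^ n / n.factorial)).toReal = _
  rw [Real.coe_toNNReal r hr, mul_div_assoc]
  exact ENNReal.toReal_ofReal (poissonMass_nonneg hr n)

lemma poissonJointLaw_apply (p : ℝ) {lam0 lam1 : ℝ} (h : lam0 ≠ lam1) (T : Fin 15 → ℝ) {k : ℕ}
    (idx : Fin k → Fin 15) {A : Set ((Fin 4 → ℝ) × (Fin k → ℕ))} (hA : MeasurableSet A) :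
    poissonJointLaw p lam0 lam1 T idx A = ∑ b, (Measure.pi fun i =>
      _root_.poissonMeasure (T (idx i) * ∑ j ∈ sens (idx i), signal lam0 lam1 b j))
        (Prod.mk (signal lam0 lam1 b) ⁻¹' A) * coinsLaw p {b} := by
  have he := measurableEmbedding_signal h
  rw [poissonJointLaw, Measure.bind_apply hA, XLaw_eq_map, he.lintegral_map, lintegral_fintype]
  · simp_rw [Measure.map_apply measurable_prodMk_left hA]
  · rw [XLaw_eq_map, he.aemeasurable_map_iff]
    exact Measurable.of_discrete.aemeasurable

lemma isProbabilityMeasure_poissonJointLaw {p : ℝ} (hp0 : 0 ≤ p) (hp1 : p ≤ 1) {lam0 lam1 : ℝ}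
    (h : lam0 ≠ lam1) (T : Fin 15 → ℝ) {k : ℕ} (idx : Fin k → Fin 15) :
    IsProbabilityMeasure (poissonJointLaw p lam0 lam1 T idx) := by
  have := isProbabilityMeasure_coinsLaw hp0 hp1
  constructor
  rw [poissonJointLaw_apply p h T idx .univ]
  simp

lemma map_fst_poissonJointLaw (p : ℝ) {lam0 lam1 : ℝ} (h : lam0 ≠ lam1) (T : Fin 15 → ℝ) {k : ℕ}
    (idx : Fin k → Fin 15) :
    (poissonJointLaw p lam0 lam1 T idx).map Prod.fst = XLaw p lam0 lam1 := by
  ext A hA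
  have he := measurableEmbedding_signal h
  rw [Measure.map_apply measurable_fst hA, poissonJointLaw_apply p h T idx (measurable_fst hA),
    ← lintegral_indicator_one hA, XLaw_eq_map, he.lintegral_map, lintegral_fintype]
  refine Finset.sum_congr rfl fun b _ => ?_
  by_cases hb : signal lam0 lam1 b ∈ A <;> simp [← Set.preimage_comp, Function.comp_def, hb]

lemma measureEntropy_XLaw {p : ℝ} (hp0 : 0 ≤ p) (hp1 : p ≤ 1) {lam0 lam1 : ℝ}
    (h : lam0 ≠ lam1) :
    measureEntropy (XLaw p lam0 lam1) = ∑ b, negMulLog ((coinsLaw p).real {b}) := by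
  have := isProbabilityMeasure_XLaw hp0 hp1 lam0 lam1
  have he := measurableEmbedding_signal h
  rw [measureEntropy_eq_tsum_of_injective _ he.injective, tsum_fintype]
  · simp [XLaw_eq_map, measureReal_def, he.map_apply, ← Set.image_singleton,
      Set.preimage_image_eq _ he.injective]
  · intro x hx
    simp [XLaw_eq_map, measureReal_def, he.map_apply, Set.preimage_singleton_eq_empty.2 hx]

/-- The probability that the total input rate equals `t`. -/
def sumMass (p lam0 lam1 t : ℝ) : ℝ :=
  ∑ b with ∑ j, signal lam0 lam1 b j = t, (coinsLaw p).real {b}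

lemma sumMass_nonneg (p lam0 lam1 t : ℝ) : 0 ≤ sumMass p lam0 lam1 t :=
  Finset.sum_nonneg fun _ _ => measureReal_nonneg

/-- The possible total input rates. -/
def sumRates (lam0 lam1 : ℝ) : Finset ℝ :=
  Finset.univ.image fun b => ∑ j, signal lam0 lam1 b j

lemma sum_coinsLaw_mul_eq_sum_sumMass_mul (p lam0 lam1 : ℝ) (f : ℝ → ℝ) :
    ∑ b, (coinsLaw p).real {b} * f (∑ j, signal lam0 lam1 b j) =
      ∑ t ∈ sumRates lam0 lam1, sumMass p lam0 lam1 t * f t := by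
  rw [← Finset.sum_fiberwise_of_maps_to (t := sumRates lam0 lam1)
    (g := fun b => ∑ j, signal lam0 lam1 b j) fun b hb => Finset.mem_image_of_mem _ hb]
  refine Finset.sum_congr rfl fun t _ => ?_
  rw [sumMass, Finset.sum_mul]
  refine Finset.sum_congr rfl fun b hb => ?_
  rw [(Finset.mem_filter.1 hb).2]

lemma measureEntropy_map_sum_XLaw {p : ℝ} (hp0 : 0 ≤ p) (hp1 : p ≤ 1) (lam0 lam1 : ℝ) :
    measureEntropy ((XLaw p lam0 lam1).map fun x => ∑ j, x j) =
      ∑ t ∈ sumRates lam0 lam1, negMulLog (sumMass p lam0 lam1 t) := by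
  have := isProbabilityMeasure_XLaw hp0 hp1 lam0 lam1
  have hm : Measurable fun x : Fin 4 → ℝ => ∑ j, x j := by fun_prop
  have := Measure.isProbabilityMeasure_map (μ := XLaw p lam0 lam1) hm.aemeasurable
  have hmass (t : ℝ) :
      ((XLaw p lam0 lam1).map fun x => ∑ j, x j).real {t} = sumMass p lam0 lam1 t := by
    rw [XLaw_eq_map, Measure.map_map hm .of_discrete,
      map_measureReal_apply .of_discrete (measurableSet_singleton t), sumMass,
      sum_measureReal_singleton]
    congr 1
    ext b
    simp
  rw [measureEntropy_eq_tsum_real]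
  simp_rw [hmass]
  refine tsum_eq_sum fun t ht => ?_
  have : sumMass p lam0 lam1 t = 0 := Finset.sum_eq_zero fun b hb =>
    (ht ((Finset.mem_filter.1 hb).2 ▸ Finset.mem_image_of_mem _ (Finset.mem_univ b))).elim
  rw [this, negMulLog_zero]

/-- The joint law of the input and the output of the joint sensing scheme. -/
def jointSensingLaw (p lam0 lam1 T : ℝ) : Measure ((Fin 4 → ℝ) × (Fin 1 → ℕ)) :=
  poissonJointLaw p lam0 lam1 (fun i => if i.val = 14 then T else 0) fun _ => 14

lemma jointSensingLaw_apply (p : ℝ) {lam0 lam1 : ℝ} (h : lam0 ≠ lam1) (T : ℝ)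
    {A : Set ((Fin 4 → ℝ) × (Fin 1 → ℕ))} (hA : MeasurableSet A) :
    jointSensingLaw p lam0 lam1 T A = ∑ b, (Measure.pi fun _ : Fin 1 =>
      _root_.poissonMeasure (T * ∑ j, signal lam0 lam1 b j))
        (Prod.mk (signal lam0 lam1 b) ⁻¹' A) * coinsLaw p {b} := by
  have hs : sens 14 = Finset.univ := by decide
  rw [jointSensingLaw, poissonJointLaw_apply p h _ _ hA, hs]
  rfl

lemma sum_signal_nonneg {lam0 lam1 : ℝ} (h0 : 0 ≤ lam0) (h1 : 0 ≤ lam1) (b : Fin 4 → Bool) :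
    0 ≤ ∑ j, signal lam0 lam1 b j :=
  Finset.sum_nonneg fun j _ => by cases hb : b j <;> simpa [signal, hb]

lemma real_pi_poissonMeasure_singleton {r : ℝ} (hr : 0 ≤ r) (y : Fin 1 → ℕ) :
    (Measure.pi fun _ : Fin 1 => _root_.poissonMeasure r).real {y} = poissonMass r (y 0) := by
  rw [← real_poissonMeasure_singleton hr, measureReal_def, Measure.pi_singleton]
  simp [measureReal_def]

lemma measureEntropy_map_snd_jointSensingLaw {p lam0 lam1 T : ℝ} (hp0 : 0 ≤ p) (hp1 : p ≤ 1)
    (h0 : 0 ≤ lam0) (h : lam0 < lam1) (hT : 0 ≤ T) :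
    measureEntropy ((jointSensingLaw p lam0 lam1 T).map Prod.snd) =
      ∑' n, negMulLog (∑ b, (coinsLaw p).real {b} *
        poissonMass (T * ∑ j, signal lam0 lam1 b j) n) := by
  have : IsProbabilityMeasure (jointSensingLaw p lam0 lam1 T) :=
    isProbabilityMeasure_poissonJointLaw hp0 hp1 h.ne _ _
  have := Measure.isProbabilityMeasure_map (μ := jointSensingLaw p lam0 lam1 T)
    measurable_snd.aemeasurable
  rw [measureEntropy_eq_tsum_real, ← (Equiv.funUnique (Fin 1) ℕ).symm.tsum_eq]
  refine tsum_congr fun n => congrArg _ ?_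
  rw [measureReal_def, Measure.map_apply measurable_snd (measurableSet_singleton _),
    jointSensingLaw_apply p h.ne T (measurable_snd (measurableSet_singleton _)),
    ENNReal.toReal_sum fun b _ => ENNReal.mul_ne_top (measure_ne_top _ _) (measure_ne_top _ _)]
  refine Finset.sum_congr rfl fun b _ => ?_
  rw [ENNReal.toReal_mul, mul_comm]
  congr 1
  exact real_pi_poissonMeasure_singleton
    (mul_nonneg hT (sum_signal_nonneg h0 (h0.trans h.le) b)) _

lemma measureEntropy_jointSensingLaw {p lam0 lam1 T : ℝ} (hp0 : 0 ≤ p) (hp1 : p ≤ 1)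
    (h0 : 0 ≤ lam0) (h : lam0 < lam1) (hT : 0 ≤ T) :
    measureEntropy (jointSensingLaw p lam0 lam1 T) =
      ∑ b, (negMulLog ((coinsLaw p).real {b}) + (coinsLaw p).real {b} *
        ∑' n, negMulLog (poissonMass (T * ∑ j, signal lam0 lam1 b j) n)) := by
  have : IsProbabilityMeasure (jointSensingLaw p lam0 lam1 T) :=
    isProbabilityMeasure_poissonJointLaw hp0 hp1 h.ne _ _
  have hr (b) : 0 ≤ T * ∑ j, signal lam0 lam1 b j :=
    mul_nonneg hT (sum_signal_nonneg h0 (h0.trans h.le) b)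
  have hinj := signal_injective h.ne
  set g : (Fin 4 → Bool) × ℕ → (Fin 4 → ℝ) × (Fin 1 → ℕ) :=
    Prod.map (signal lam0 lam1) (Equiv.funUnique (Fin 1) ℕ).symm with hg
  have hmass (c) : (jointSensingLaw p lam0 lam1 T).real {g c} =
      (coinsLaw p).real {c.1} * poissonMass (T * ∑ j, signal lam0 lam1 c.1 j) c.2 := by
    rw [measureReal_def, jointSensingLaw_apply p h.ne T (measurableSet_singleton _),
      Finset.sum_eq_single c.1, ENNReal.toReal_mul, mul_comm]
    · congr 1
      have : Prod.mk (signal lam0 lam1 c.1) ⁻¹' {g c} =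
          {(Equiv.funUnique (Fin 1) ℕ).symm c.2} := by
        ext y; simp [hg, Prod.map, Prod.ext_iff]
      rw [this]
      exact real_pi_poissonMeasure_singleton (hr _) _
    · intro b _ hb
      have : Prod.mk (signal lam0 lam1 b) ⁻¹' {g c} = ∅ := by
        ext y; simp [hg, Prod.map, hinj.ne hb]
      rw [this, measure_empty, zero_mul]
    · simp
  have hsum (b) : HasSum (fun n => negMulLog ((coinsLaw p).real {b} *
      poissonMass (T * ∑ j, signal lam0 lam1 b j) n)) (negMulLog ((coinsLaw p).real {b}) +
        (coinsLaw p).real {b} * ∑' n, negMulLog (poissonMass (T * ∑ j, signal lam0 lam1 b j) n)) :=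
    hasSum_negMulLog_mul_poissonMass _ (hr b)
  have hs : Summable fun c : (Fin 4 → Bool) × ℕ => negMulLog ((coinsLaw p).real {c.1} *
      poissonMass (T * ∑ j, signal lam0 lam1 c.1 j) c.2) := by
    refine (summable_prod_of_nonneg fun c => ?_).2 ⟨fun b => (hsum b).summable, .of_finite⟩
    rw [← hmass]
    exact negMulLog_nonneg measureReal_nonneg measureReal_le_one
  rw [measureEntropy_eq_tsum_of_injective _
    (g := g) (hinj.prodMap (Equiv.injective _))]
  · simp_rw [hmass]
    rw [hs.tsum_prod'
      fun b => (hsum b).summable, tsum_fintype]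
    exact Finset.sum_congr rfl fun b _ => (hsum b).tsum_eq
  · rintro ⟨x, y⟩ hxy
    rw [measureReal_def, jointSensingLaw_apply p h.ne T (measurableSet_singleton _),
      Finset.sum_eq_zero, ENNReal.toReal_zero]
    intro b _
    have : Prod.mk (signal lam0 lam1 b) ⁻¹' {(x, y)} = ∅ := by
      refine Set.eq_empty_of_forall_notMem fun z hz => hxy ⟨(b, z 0), ?_⟩
      rw [← Set.mem_singleton_iff.1 hz, hg]
      exact Prod.ext rfl ((Equiv.funUnique (Fin 1) ℕ).symm_apply_apply z)
    rw [this, measure_empty, zero_mul]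

lemma measureMutualInfo_jointSensingLaw {p lam0 lam1 T : ℝ} (hp0 : 0 ≤ p) (hp1 : p ≤ 1)
    (h0 : 0 ≤ lam0) (h : lam0 < lam1) (hT : 0 ≤ T) :
    measureMutualInfo (jointSensingLaw p lam0 lam1 T) =
      ∑' n, negMulLog (∑ t ∈ sumRates lam0 lam1,
        sumMass p lam0 lam1 t * poissonMass (T * t) n) -
      ∑ t ∈ sumRates lam0 lam1,
        sumMass p lam0 lam1 t * ∑' n, negMulLog (poissonMass (T * t) n) := by
  simp only [← sum_coinsLaw_mul_eq_sum_sumMass_mul p lam0 lam1 fun t => poissonMass (T * t) _,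
    ← sum_coinsLaw_mul_eq_sum_sumMass_mul p lam0 lam1
      fun t => ∑' n, negMulLog (poissonMass (T * t) n)]
  rw [measureMutualInfo, measureEntropy_map_snd_jointSensingLaw hp0 hp1 h0 h hT,
    measureEntropy_jointSensingLaw hp0 hp1 h0 h hT, jointSensingLaw,
    map_fst_poissonJointLaw p h.ne, measureEntropy_XLaw hp0 hp1 h.ne, Finset.sum_add_distrib]
  ring

/-- assuming `λ₀ > 0`, for the joint sensing scheme (`T₁₅ = T`, all other
times `0`) the mutual information `I(X; Y₁₅)` tends to the Shannon entropy
`H(X₁+X₂+X₃+X₄)` of the sum as `T → ∞`. -/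
theorem poisson_mutualInfo_joint_tendsto_entropy_sum
    (p lam0 lam1 : ℝ) (hlam0 : 0 < lam0) (hlam : lam0 < lam1) (hp0 : 0 < p) (hp1 : p < 1) :
    Tendsto (fun T : ℝ =>
        measureMutualInfo (poissonJointLaw p lam0 lam1
          (fun i => if i.val = 14 then T else 0)
          (fun _ : Fin 1 => (14 : Fin 15))))
      atTop
      (nhds (measureEntropy ((XLaw p lam0 lam1).map (fun x => ∑ j, x j)))) := by
  rw [measureEntropy_map_sum_XLaw hp0.le hp1.le]
  refine (tendsto_poisson_mixture_mutualInfo (sumRates lam0 lam1) (q := sumMass p lam0 lam1)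
    (fun t _ => sumMass_nonneg p lam0 lam1 t) fun t ht => ?_).congr' ?_
  · obtain ⟨b, -, rfl⟩ := Finset.mem_image.1 ht
    exact sum_signal_nonneg hlam0.le (hlam0.le.trans hlam.le) b
  · filter_upwards [eventually_ge_atTop 0] with T hT
    exact (measureMutualInfo_jointSensingLaw hp0.le hp1.le hlam0.le hlam hT).symm
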